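/- Let (u,w,π) be a smooth solution of the 2D micropolar equations with only angular viscosity dissipation on a bounded domain D ⊂ ℝ², and let Ω = ∇×u denote the vorticity, which satisfies Ω_t + u·∇Ω = −2κΔw. Then the combined quantity Z = Ω + (2κ/γ)w satisfies the equation ∂_t Z + u·∇Z − (4κ²/γ)Z + (8κ²/γ)(1 + κ/γ)w = 0, which contains no second-order derivative terms. -/

import Mathlib

open MeasureTheory Set Bornology Filter

noncomputable section

variable {E : Type*} [NormedAddCommGroup E] [NormedSpace ℝ E]

/-- First spatial partial derivative of a function on `ℝ²`. -/
def pd1 (f : ℝ × ℝ → E) (x : ℝ × ℝ) : E := fderiv ℝ f x (1, 0)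

/-- Second spatial partial derivative of a function on `ℝ²`. -/
def pd2 (f : ℝ × ℝ → E) (x : ℝ × ℝ) : E := fderiv ℝ f x (0, 1)

/-- Gradient of a scalar function on `ℝ²`. -/
def grad2 (f : ℝ × ℝ → ℝ) (x : ℝ × ℝ) : ℝ × ℝ := (pd1 f x, pd2 f x)

/-- Perpendicular gradient `∇⊥ f = (∂₂ f, −∂₁ f)`. -/
def perpGrad (f : ℝ × ℝ → ℝ) (x : ℝ × ℝ) : ℝ × ℝ := (pd2 f x, - pd1 f x)

/-- Scalar curl of a planar vector field: `∇×u = ∂₁u₂ − ∂₂u₁`. -/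
def curl2 (u : ℝ × ℝ → ℝ × ℝ) (x : ℝ × ℝ) : ℝ :=
  pd1 (fun y => (u y).2) x - pd2 (fun y => (u y).1) x

/-- Divergence of a planar vector field. -/
def div2 (u : ℝ × ℝ → ℝ × ℝ) (x : ℝ × ℝ) : ℝ :=
  pd1 (fun y => (u y).1) x + pd2 (fun y => (u y).2) x

/-- Laplacian of a scalar function on `ℝ²`. -/
def lap2 (f : ℝ × ℝ → ℝ) (x : ℝ × ℝ) : ℝ := pd1 (pd1 f) x + pd2 (pd2 f) x

/-- Advective derivative `u·∇f` of a scalar function. -/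
def advS (u : ℝ × ℝ → ℝ × ℝ) (f : ℝ × ℝ → ℝ) (x : ℝ × ℝ) : ℝ :=
  (u x).1 * pd1 f x + (u x).2 * pd2 f x

/-- Advective derivative `u·∇v` of a vector field. -/
def advV (u v : ℝ × ℝ → ℝ × ℝ) (x : ℝ × ℝ) : ℝ × ℝ :=
  (u x).1 • pd1 v x + (u x).2 • pd2 v x

/-- Euclidean inner product on `ℝ²`. -/
def dot2 (a b : ℝ × ℝ) : ℝ := a.1 * b.1 + a.2 * b.2

/-- Time derivative of a time-dependent field. -/
def tderiv (f : ℝ → ℝ × ℝ → E) : ℝ → ℝ × ℝ → E :=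
  fun t x => deriv (fun s => f s x) t

/-- Squared `L²(D)` norm. -/
def l2sq (D : Set (ℝ × ℝ)) (f : ℝ × ℝ → E) : ℝ := ∫ x in D, ‖f x‖ ^ 2

/-- Squared `H^k(D)` Sobolev norm (via classical derivatives). -/
def sobSq (D : Set (ℝ × ℝ)) (k : ℕ) (f : ℝ × ℝ → E) : ℝ :=
  ∑ i ∈ Finset.range (k + 1), ∫ x in D, ‖iteratedFDeriv ℝ i f x‖ ^ 2

/-- `W^{k,p}(D)` Sobolev norm (via classical derivatives), `p` a real exponent. -/
def sobWp (D : Set (ℝ × ℝ)) (k : ℕ) (p : ℝ) (f : ℝ × ℝ → E) : ℝ :=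
  ∑ i ∈ Finset.range (k + 1), (∫ x in D, ‖iteratedFDeriv ℝ i f x‖ ^ p) ^ (1 / p)

/-- `L^p(D)` norm, `p` a real exponent. -/
def lpNorm2 (D : Set (ℝ × ℝ)) (p : ℝ) (f : ℝ × ℝ → E) : ℝ :=
  (∫ x in D, ‖f x‖ ^ p) ^ (1 / p)

/-- Membership in `H^k(D)` (all derivatives up to order `k` square-integrable on `D`). -/
def MemSob (D : Set (ℝ × ℝ)) (k : ℕ) (f : ℝ × ℝ → E) : Prop :=
  ∀ i ≤ k, IntegrableOn (fun x => ‖iteratedFDeriv ℝ i f x‖ ^ 2) D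

/-- A bounded domain in the plane, with outward unit normal field `n` on its boundary. -/
def BoundedDomain (D : Set (ℝ × ℝ)) (n : ℝ × ℝ → ℝ × ℝ) : Prop :=
  IsOpen D ∧ IsConnected D ∧ Bornology.IsBounded D ∧ ∀ x ∈ frontier D, ‖n x‖ = 1

/-- Joint space-time smoothness of a time-dependent field. -/
def SmoothST (f : ℝ → ℝ × ℝ → E) : Prop :=
  ContDiff ℝ (⊤ : ℕ∞) (fun p : ℝ × (ℝ × ℝ) => f p.1 p.2)

/-- The 2D micropolar equations with only angular viscosity dissipation,
holding on `D` for times in `I`: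
`u_t + u·∇u + ∇π = 2κ∇⊥w`, `w_t − γΔw + 4κw + u·∇w = 2κ∇×u`, `∇·u = 0`. -/
def Micropolar (κ γ : ℝ) (D : Set (ℝ × ℝ)) (I : Set ℝ)
    (u : ℝ → ℝ × ℝ → ℝ × ℝ) (w π : ℝ → ℝ × ℝ → ℝ) : Prop :=
  ∀ t ∈ I, ∀ x ∈ D,
    tderiv u t x + advV (u t) (u t) x + grad2 (π t) x = (2 * κ) • perpGrad (w t) x ∧
    tderiv w t x - γ * lap2 (w t) x + 4 * κ * w t x + advS (u t) (w t) x
      = 2 * κ * curl2 (u t) x ∧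
    div2 (u t) x = 0

/-- The damped 2D micropolar system:
`u_t + κu + u·∇u + ∇π = 2κ∇⊥w`, `w_t − γΔw + u·∇w = 2κ∇×u`, `∇·u = 0`. -/
def DampedMicropolar (κ γ : ℝ) (D : Set (ℝ × ℝ)) (I : Set ℝ)
    (u : ℝ → ℝ × ℝ → ℝ × ℝ) (w π : ℝ → ℝ × ℝ → ℝ) : Prop :=
  ∀ t ∈ I, ∀ x ∈ D,
    tderiv u t x + κ • u t x + advV (u t) (u t) x + grad2 (π t) x
      = (2 * κ) • perpGrad (w t) x ∧
    tderiv w t x - γ * lap2 (w t) x + advS (u t) (w t) x = 2 * κ * curl2 (u t) x ∧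
    div2 (u t) x = 0

/-- Boundary conditions `u·n = 0` and `w = 0` on `∂D`. -/
def MicropolarBC (D : Set (ℝ × ℝ)) (n : ℝ × ℝ → ℝ × ℝ) (I : Set ℝ)
    (u : ℝ → ℝ × ℝ → ℝ × ℝ) (w : ℝ → ℝ × ℝ → ℝ) : Prop :=
  ∀ t ∈ I, ∀ x ∈ frontier D, dot2 (u t x) (n x) = 0 ∧ w t x = 0

/-- The compatibility conditions on the initial data `(u₀, w₀)`:
`u₀·n = 0`, `w₀ = 0` on `∂D`, `∇·u₀ = 0`, and, with `π₀` solving the associated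
Neumann problem, `u₀·∇u₀ + ∇π₀ = 2κ∇⊥w₀` and `4κw₀ + u₀·∇w₀ = γΔw₀ + 2κ∇×u₀` on `∂D`. -/
def CompatConds (κ γ : ℝ) (D : Set (ℝ × ℝ)) (n : ℝ × ℝ → ℝ × ℝ)
    (u₀ : ℝ × ℝ → ℝ × ℝ) (w₀ : ℝ × ℝ → ℝ) : Prop :=
  (∀ x ∈ frontier D, dot2 (u₀ x) (n x) = 0 ∧ w₀ x = 0) ∧
  (∀ x ∈ D, div2 u₀ x = 0) ∧
  ∃ π₀ : ℝ × ℝ → ℝ,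
    (∀ x ∈ frontier D,
      dot2 (grad2 π₀ x) (n x)
        = dot2 ((2 * κ) • perpGrad w₀ x - advV u₀ u₀ x) (n x)) ∧
    (∀ x ∈ frontier D, advV u₀ u₀ x + grad2 π₀ x = (2 * κ) • perpGrad w₀ x) ∧
    (∀ x ∈ frontier D,
      4 * κ * w₀ x + advS u₀ w₀ x = γ * lap2 w₀ x + 2 * κ * curl2 u₀ x)

/-- The regularity class of Theorem 1:
`u ∈ L^∞(0,T;H¹(D))`, `Ω ∈ L^∞(0,T;L^∞(D))`, `w ∈ L^∞(0,T;H²(D))` for every `T > 0`. -/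
def Thm1Class (D : Set (ℝ × ℝ)) (u : ℝ → ℝ × ℝ → ℝ × ℝ) (w : ℝ → ℝ × ℝ → ℝ) : Prop :=
  ∀ T > (0:ℝ), ∃ C : ℝ, ∀ t ∈ Icc (0:ℝ) T,
    sobSq D 1 (u t) ≤ C ∧ (∀ x ∈ D, |curl2 (u t) x| ≤ C) ∧ sobSq D 2 (w t) ≤ C

/-- Slices of a smooth space-time field at a fixed time are smooth in space. -/
theorem SmoothST.slice {f : ℝ → ℝ × ℝ → E} (hf : SmoothST f) (t : ℝ) :
    ContDiff ℝ (⊤ : ℕ∞) (f t) :=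
  ContDiff.comp (g := fun p : ℝ × (ℝ × ℝ) => f p.1 p.2) hf (contDiff_prodMk_right t)

/-- Slices of a smooth space-time field at a fixed point are smooth in time. -/
theorem SmoothST.time_slice {f : ℝ → ℝ × ℝ → E} (hf : SmoothST f) (x : ℝ × ℝ) :
    ContDiff ℝ (⊤ : ℕ∞) (fun s => f s x) :=
  ContDiff.comp (g := fun p : ℝ × (ℝ × ℝ) => f p.1 p.2) hf (contDiff_prodMk_left x)

/-- Spatial directional derivatives of a smooth space-time field are smooth in space-time. -/
theorem SmoothST.fderiv_apply {f : ℝ → ℝ × ℝ → E} (hf : SmoothST f) (v : ℝ × ℝ) :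
    SmoothST (fun t x => fderiv ℝ (f t) x v) := by
  have h : ContDiff ℝ (⊤ : ℕ∞) (fun p : ℝ × (ℝ × ℝ) => fderiv ℝ (f p.1) p.2) := by
    refine ContDiff.fderiv (n := (⊤ : ℕ∞)) (m := (⊤ : ℕ∞)) ?_ contDiff_snd (by simp)
    exact ContDiff.comp (g := fun p : ℝ × (ℝ × ℝ) => f p.1 p.2) hf
      ((contDiff_fst.comp contDiff_fst).prodMk contDiff_snd)
  exact h.clm_apply contDiff_const

/-- The vorticity of a smooth velocity field is smooth in space-time. -/
theorem SmoothST.curl2 {u : ℝ → ℝ × ℝ → ℝ × ℝ} (hu : SmoothST u) :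
    SmoothST (fun t x => curl2 (u t) x) := by
  have h₁ : SmoothST (fun t x => (u t x).1) := ContDiff.fst hu
  have h₂ : SmoothST (fun t x => (u t x).2) := ContDiff.snd hu
  exact ContDiff.sub (h₂.fderiv_apply (1, 0)) (h₁.fderiv_apply (0, 1))

/-- The time derivative is linear on smooth fields. -/
theorem tderiv_add_const_mul {f g : ℝ → ℝ × ℝ → ℝ} (hf : SmoothST f) (hg : SmoothST g)
    (c t : ℝ) (x : ℝ × ℝ) :
    tderiv (fun s y => f s y + c * g s y) t x = tderiv f t x + c * tderiv g t x := by
  have hf' : DifferentiableAt ℝ (fun s => f s x) t :=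
    (hf.time_slice x).differentiable (by simp) t
  have hg' : DifferentiableAt ℝ (fun s => g s x) t :=
    (hg.time_slice x).differentiable (by simp) t
  exact (hf'.hasDerivAt.add (hg'.hasDerivAt.const_mul c)).deriv

/-- The advective derivative is linear in the transported scalar. -/
theorem advS_add_const_mul (v : ℝ × ℝ → ℝ × ℝ) {f g : ℝ × ℝ → ℝ} {x : ℝ × ℝ}
    (hf : DifferentiableAt ℝ f x) (hg : DifferentiableAt ℝ g x) (c : ℝ) :
    advS v (fun y => f y + c * g y) x = advS v f x + c * advS v g x := by
  have h : fderiv ℝ (fun y => f y + c * g y) x = fderiv ℝ f x + c • fderiv ℝ g x :=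
    (hf.hasFDerivAt.add (hg.hasFDerivAt.const_mul c)).fderiv
  simp only [advS, pd1, pd2, h, add_apply, smul_apply,
    smul_eq_mul]
  ring

/-- The combined quantity `Z = Ω + (2κ/γ)w` satisfies
`∂_t Z + u·∇Z − (4κ²/γ)Z + (8κ²/γ)(1 + κ/γ)w = 0`, an equation with no
second-order derivative terms. -/
theorem combined_quantity_equation
    (κ γ : ℝ) (hκ : 0 < κ) (hγ : 0 < γ)
    (D : Set (ℝ × ℝ)) (n : ℝ × ℝ → ℝ × ℝ) (hD : BoundedDomain D n)
    (u₀ : ℝ × ℝ → ℝ × ℝ) (w₀ : ℝ × ℝ → ℝ)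
    (u : ℝ → ℝ × ℝ → ℝ × ℝ) (w π : ℝ → ℝ × ℝ → ℝ)
    (hsm : SmoothST u ∧ SmoothST w ∧ SmoothST π)
    (hsol : Micropolar κ γ D (Ici 0) u w π)
    (hbc : MicropolarBC D n (Ici 0) u w)
    (hvort : ∀ t ∈ Ici (0:ℝ), ∀ x ∈ D,
      tderiv (fun s y => curl2 (u s) y) t x +
          advS (u t) (fun y => curl2 (u t) y) x
        = -(2 * κ) * lap2 (w t) x) :
    ∀ t ∈ Ici (0:ℝ), ∀ x ∈ D,
      tderiv (fun s y => curl2 (u s) y + (2 * κ / γ) * w s y) t x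
        + advS (u t) (fun y => curl2 (u t) y + (2 * κ / γ) * w t y) x
        - (4 * κ ^ 2 / γ) * (curl2 (u t) x + (2 * κ / γ) * w t x)
        + (8 * κ ^ 2 / γ) * (1 + κ / γ) * w t x = 0 := by
  intro t ht x hx
  have hΩ : SmoothST (fun s y => curl2 (u s) y) := hsm.1.curl2
  rw [tderiv_add_const_mul hΩ hsm.2.1,
    advS_add_const_mul (u t) ((hΩ.slice t).differentiable (by simp) x)
      ((hsm.2.1.slice t).differentiable (by simp) x)]
  have hv := hvort t ht x hx
  have hw := (hsol t ht x hx).2.1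
  have hγ' : γ / γ = 1 := div_self hγ.ne'
  linear_combination hv + (2 * κ / γ) * hw + (2 * κ * lap2 (w t) x) * hγ'

end
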